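/- (Theorem 1, part 2 — uniqueness) Let (C, S) and (C', S') be two community structures on N nodes, L layers, and Q community labels, both satisfying the well partitioned property (WPP), both observable, and with all communities C a and C' a nonempty. If some partial community labeling t is simultaneously a natural labeling of (C, S) and of (C', S'), then C = C' and S = S'. -/

import Mathlib

/-- The well partitioned property for a community structure (C, S). -/
def WPP {N L Q : ℕ} (C : Fin Q → Set (Fin N)) (S : Fin L → Set (Fin Q)) : Prop :=
  ∀ l : Fin L, ∀ a b : Fin Q, a ∈ S l → b ∈ S l → (C a ∩ C b).Nonempty → C a = C b

/-- A community structure is observable if every label appears in some layer. -/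
def Observable {N L Q : ℕ} (_C : Fin Q → Set (Fin N)) (S : Fin L → Set (Fin Q)) : Prop :=
  ∀ a : Fin Q, ∃ l : Fin L, a ∈ S l

/-- `t` is a natural labeling of the community structure (C, S). -/
def NaturalLabeling {N L Q : ℕ} (t : Fin N → Fin L → Option (Fin Q))
    (C : Fin Q → Set (Fin N)) (S : Fin L → Set (Fin Q)) : Prop :=
  ∀ (i : Fin N) (l : Fin L) (a : Fin Q), t i l = some a ↔ (a ∈ S l ∧ i ∈ C a)

theorem stmt_6 {N L Q : ℕ} (t : Fin N → Fin L → Option (Fin Q))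
    (C C' : Fin Q → Set (Fin N)) (S S' : Fin L → Set (Fin Q))
    (hWPP : WPP C S) (hWPP' : WPP C' S')
    (hObs : Observable C S) (hObs' : Observable C' S')
    (hNe : ∀ a : Fin Q, (C a).Nonempty) (hNe' : ∀ a : Fin Q, (C' a).Nonempty)
    (hNat : NaturalLabeling t C S) (hNat' : NaturalLabeling t C' S') :
    C = C' ∧ S = S' := by
  have key (i l a) : (a ∈ S l ∧ i ∈ C a) ↔ (a ∈ S' l ∧ i ∈ C' a) :=
    (hNat i l a).symm.trans (hNat' i l a)
  constructor
  · ext a i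
    obtain ⟨l, hl⟩ := hObs a
    obtain ⟨l', hl'⟩ := hObs' a
    exact ⟨fun hi => ((key i l a).1 ⟨hl, hi⟩).2, fun hi => ((key i l' a).2 ⟨hl', hi⟩).2⟩
  · ext l a
    obtain ⟨i, hi⟩ := hNe a
    obtain ⟨i', hi'⟩ := hNe' a
    exact ⟨fun hl => ((key i l a).1 ⟨hl, hi⟩).1, fun hl => ((key i' l a).2 ⟨hl, hi'⟩).1⟩
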